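/- Let m ≥ 1, a, b ≥ 1, and let ρ be the canonical sequential form of a non-crossing partition of length m. If n ≥ m + a + b − 1, then the total number of occurrences of the subword τ = 1^a(ρ+1)1^b over all non-crossing partitions of [n] equals binom(2r, r+1), where r = n − m − a − b + 1. -/

import Mathlib

/-- `l` is a restricted growth sequence (canonical sequential form of a set
partition): it starts with 1, all letters are ≥ 1, and each letter is at most
one more than the maximum of the preceding prefix. -/
def IsRGS (l : List ℕ) : Prop :=
  l.getD 0 1 = 1 ∧ (∀ x ∈ l, 1 ≤ x) ∧
  ∀ i, i + 1 < l.length → l.getD (i + 1) 0 ≤ (l.take (i + 1)).foldr max 0 + 1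

/-- `l` contains a (classical) occurrence of 1-2-1-2: a subsequence a,b,a,b with a < b. -/
def Crossing (l : List ℕ) : Prop :=
  ∃ i j k m : ℕ, i < j ∧ j < k ∧ k < m ∧ m < l.length ∧
    l.getD i 0 = l.getD k 0 ∧ l.getD j 0 = l.getD m 0 ∧ l.getD i 0 < l.getD j 0

/-- `l` is the canonical sequential form of a non-crossing partition of [n]. -/
def NCseq (n : ℕ) (l : List ℕ) : Prop := l.length = n ∧ IsRGS l ∧ ¬ Crossing l

/-- Two lists of the same length are order-isomorphic. -/
def OrdIso (s t : List ℕ) : Prop :=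
  s.length = t.length ∧ ∀ j k, j < s.length → k < s.length →
    (s.getD j 0 < s.getD k 0 ↔ t.getD j 0 < t.getD k 0)

/-- The subword pattern `τ` occurs in `l` starting at position `i`. -/
def occAt (τ l : List ℕ) (i : ℕ) : Prop := OrdIso τ ((l.drop i).take τ.length)

/-- The number of occurrences of the subword pattern `τ` in `l`. -/
noncomputable def occCount (τ l : List ℕ) : ℕ := Nat.card {i : ℕ // occAt τ l i}

/-- The total number of occurrences of the subword pattern `τ` over all
members of NC_n, counted with multiplicity (as marked occurrences). -/
noncomputable def totalOcc (n : ℕ) (τ : List ℕ) : ℕ :=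
  Nat.card {p : List ℕ × ℕ // NCseq n p.1 ∧ occAt τ p.1 p.2}

open List

/-- `Growth N l`: the word `l` may follow a prefix with maximum `N` in a restricted growth
sequence. -/
def Growth : ℕ → List ℕ → Prop
  | _, [] => True
  | N, x :: l => (1 ≤ x ∧ x ≤ N + 1) ∧ Growth (max N x) l

/-- The largest letter of a word, `0` for the empty word. -/
def maxLetter (l : List ℕ) : ℕ := l.foldr max 0

@[simp] theorem maxLetter_nil : maxLetter [] = 0 := rfl

@[simp] theorem maxLetter_cons (x : ℕ) (l : List ℕ) :
    maxLetter (x :: l) = max x (maxLetter l) := rfl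

@[simp] theorem maxLetter_append (s t : List ℕ) :
    maxLetter (s ++ t) = max (maxLetter s) (maxLetter t) := by
  induction s with
  | nil => simp
  | cons x s ih => simp [ih, max_assoc]

theorem le_maxLetter {x : ℕ} {l : List ℕ} (h : x ∈ l) : x ≤ maxLetter l := by
  induction l with
  | nil => simp at h
  | cons y l ih =>
    rcases List.mem_cons.1 h with rfl | h
    · simp
    · simp [ih h]

theorem max_maxLetter_map_add (M : ℕ) (l : List ℕ) :
    max M (maxLetter (l.map (· + M))) = M + maxLetter l := by
  induction l with
  | nil => simp
  | cons y l ih => simp only [List.map_cons, maxLetter_cons]; omega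

theorem growth_append {N : ℕ} {s t : List ℕ} :
    Growth N (s ++ t) ↔ Growth N s ∧ Growth (max N (maxLetter s)) t := by
  induction s generalizing N with
  | nil => simp [Growth]
  | cons x s ih => simp [Growth, ih, and_assoc, max_assoc]

theorem Growth.pos {N : ℕ} {l : List ℕ} (h : Growth N l) : ∀ x ∈ l, 1 ≤ x := by
  induction l generalizing N with
  | nil => simp
  | cons y l ih =>
    intro x hx
    rcases List.mem_cons.1 hx with rfl | hx
    · exact h.1.1
    · exact ih h.2 x hx

theorem Growth.mem {N x : ℕ} {l : List ℕ} (h : Growth N l) (hN : N < x) (hx : x ≤ maxLetter l) :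
    x ∈ l := by
  induction l generalizing N with
  | nil => simp at hx; omega
  | cons y l ih =>
    obtain ⟨⟨h1, h2⟩, h3⟩ := h
    by_cases hxy : x = y
    · simp [hxy]
    · refine List.mem_cons_of_mem _ (ih h3 ?_ ?_)
      · omega
      · simp only [maxLetter_cons] at hx
        omega

theorem growth_map_add {N M : ℕ} {l : List ℕ} (hl : ∀ x ∈ l, 1 ≤ x) :
    Growth (N + M) (l.map (· + M)) ↔ Growth N l := by
  induction l generalizing N with
  | nil => simp [Growth]
  | cons x l ih =>
    have hx := hl x (by simp)
    have := @ih (max N x) (fun y hy => hl y (by simp [hy]))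
    simp only [List.map_cons, Growth, ← this, Nat.add_max_add_right]
    refine and_congr_left fun _ => ?_
    omega

/-- Raise the letters above `M` by `K`. -/
def shift (M K v : ℕ) : ℕ := if v ≤ M then v else v + K

theorem shift_strictMono (M K : ℕ) : StrictMono (shift M K) := by
  intro u v h
  unfold shift
  split_ifs <;> omega

theorem growth_map_shift {N M K : ℕ} {l : List ℕ} (h : M ≤ N) :
    Growth (N + K) (l.map (shift M K)) ↔ Growth N l := by
  induction l generalizing N with
  | nil => simp [Growth]
  | cons x l ih =>
    have := @ih (max N x) (by omega)
    have e : max (N + K) (shift M K x) = max N x + K := by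
      unfold shift; split_ifs <;> omega
    simp only [List.map_cons, Growth, e, this]
    refine and_congr_left fun _ => ?_
    unfold shift; split_ifs <;> omega

theorem growth_iff_getD {N : ℕ} {l : List ℕ} :
    Growth N l ↔ ∀ i < l.length, 1 ≤ l.getD i 0 ∧ l.getD i 0 ≤ max N (maxLetter (l.take i)) + 1 := by
  induction l generalizing N with
  | nil => simp [Growth]
  | cons x l ih =>
    simp only [Growth, ih, List.length_cons]
    constructor
    · rintro ⟨h0, h⟩ i hi
      cases i with
      | zero => simpa using h0
      | succ i => simpa [max_assoc] using h i (by omega)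
    · intro h
      refine ⟨by simpa using h 0 (by omega), fun i hi => ?_⟩
      simpa [max_assoc] using h (i + 1) (by omega)

theorem isRGS_iff_growth {l : List ℕ} : IsRGS l ↔ Growth 0 l := by
  rw [growth_iff_getD]
  constructor
  · rintro ⟨h0, h1, h2⟩ i hi
    have hp : 1 ≤ l.getD i 0 := by
      rw [List.getD_eq_getElem _ _ hi]
      exact h1 _ (List.getElem_mem hi)
    refine ⟨hp, ?_⟩
    cases i with
    | zero =>
      rw [List.getD_eq_getElem _ _ hi] at h0 ⊢
      omega
    | succ i => simpa [maxLetter] using h2 i hi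
  · intro h
    refine ⟨?_, ?_, ?_⟩
    · cases l with
      | nil => simp
      | cons x l =>
        have := h 0 (by simp)
        simp at this ⊢
        omega
    · intro x hx
      obtain ⟨i, hi, rfl⟩ := List.getElem_of_mem hx
      have := (h i hi).1
      rwa [List.getD_eq_getElem _ _ hi] at this
    · intro i hi
      simpa [maxLetter] using (h (i + 1) hi).2

theorem cons_sublist_iff_getD {x : ℕ} {w l : List ℕ} :
    x :: w <+ l ↔ ∃ i < l.length, l.getD i 0 = x ∧ w <+ l.drop (i + 1) := by
  induction l with
  | nil => simp
  | cons y l ih =>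
    constructor
    · intro h
      cases h with
      | cons _ h =>
        obtain ⟨i, hi, e, hs⟩ := ih.1 h
        exact ⟨i + 1, by simpa using hi, by simpa using e, by simpa using hs⟩
      | cons_cons _ h => exact ⟨0, by simp, by simp, by simpa using h⟩
    · rintro ⟨i, hi, e, hs⟩
      cases i with
      | zero =>
        obtain rfl : y = x := by simpa using e
        exact (by simpa using hs : w <+ l).cons_cons y
      | succ i =>
        exact (ih.2 ⟨i, by simpa using hi, by simpa using e, by simpa using hs⟩).cons y

theorem crossing_iff_sublist {l : List ℕ} :
    Crossing l ↔ ∃ u v, u < v ∧ [u, v, u, v] <+ l := by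
  simp only [cons_sublist_iff_getD, List.nil_sublist, and_true, List.length_drop]
  have hd : ∀ i j, (l.drop i).getD j 0 = l.getD (i + j) 0 := by
    intro i j; simp [List.getD_eq_getElem?_getD, List.getElem?_drop]
  simp only [hd, List.drop_drop]
  constructor
  · rintro ⟨i, j, k, m, hij, hjk, hkm, hm, e1, e2, hlt⟩
    refine ⟨_, _, hlt, i, by omega, rfl, j - (i + 1), by omega, ?_, k - (j + 1), by omega, ?_,
      m - (k + 1), by omega, ?_⟩
    · congr 1; omega
    · rw [e1]; congr 1; omega
    · rw [e2]; congr 1; omega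
  · rintro ⟨u, v, hlt, i, hi, e1, j, hj, e2, k, hk, e3, m, hm, e4⟩
    refine ⟨i, _, _, _, ?_, ?_, ?_, ?_, e1.trans e3.symm, e2.trans e4.symm, ?_⟩
    · omega
    · omega
    · omega
    · omega
    · rw [e1, e2]; exact hlt

theorem crossing_map {f : ℕ → ℕ} (hf : StrictMono f) {l : List ℕ} :
    Crossing (l.map f) ↔ Crossing l := by
  simp only [crossing_iff_sublist]
  constructor
  · rintro ⟨u, v, huv, h⟩
    obtain ⟨w, hw, e⟩ := List.sublist_map_iff.1 h
    have hlen : w.length = 4 := by simpa using (congrArg List.length e).symm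
    obtain ⟨p, q, r, s, rfl⟩ := List.length_eq_four.1 hlen
    simp only [List.map_cons, List.map_nil, List.cons.injEq, and_true] at e
    obtain ⟨rfl, rfl, h1, h2⟩ := e
    obtain rfl := hf.injective h1
    obtain rfl := hf.injective h2
    exact ⟨p, q, hf.lt_iff_lt.1 huv, hw⟩
  · rintro ⟨u, v, huv, h⟩
    exact ⟨f u, f v, hf huv, by simpa using h.map f⟩

theorem cons_sublist_append_of_notMem {x : ℕ} {w s t : List ℕ} (hx : x ∉ s)
    (h : x :: w <+ s ++ t) : x :: w <+ t := by
  induction s with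
  | nil => simpa using h
  | cons y s ih =>
    simp only [List.mem_cons, not_or] at hx
    rw [List.cons_append] at h
    cases h with
    | cons _ h => exact ih hx.2 h
    | cons_cons _ h => exact absurd rfl hx.1

theorem mem_of_sublist_between {x y : ℕ} {P C Q : List ℕ} (hP : x ∉ P) (hQ : x ∉ Q)
    (h : [x, y, x] <+ P ++ C ++ Q) : y ∈ C := by
  rw [List.append_assoc] at h
  have h1 := cons_sublist_append_of_notMem hP h
  have h2 : x :: [y, x] <+ Q.reverse ++ C.reverse := by simpa using h1.reverse
  have h3 := cons_sublist_append_of_notMem (by simpa using hQ) h2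
  have := h3.subset (show y ∈ [x, y, x] by simp)
  simpa using this

theorem crossing_append_iff {P C Q : List ℕ} (hP : ∀ x ∈ C, x ∉ P) (hQ : ∀ x ∈ C, x ∉ Q) :
    Crossing (P ++ C ++ Q) ↔ Crossing C ∨ Crossing (P ++ Q) := by
  simp only [crossing_iff_sublist]
  constructor
  · rintro ⟨u, v, huv, h⟩
    by_cases hu : u ∈ C <;> by_cases hv : v ∈ C
    · left
      refine ⟨u, v, huv, ?_⟩
      have := h.filter (fun z => decide (z ∈ C))
      have e1 : P.filter (fun z => decide (z ∈ C)) = [] := by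
        simp only [List.filter_eq_nil_iff, decide_eq_true_eq]
        exact fun z hz hc => hP z hc hz
      have e2 : Q.filter (fun z => decide (z ∈ C)) = [] := by
        simp only [List.filter_eq_nil_iff, decide_eq_true_eq]
        exact fun z hz hc => hQ z hc hz
      have e3 : C.filter (fun z => decide (z ∈ C)) = C := by simp
      simpa [hu, hv, e1, e2, e3] using this
    · exact absurd (mem_of_sublist_between (hP u hu) (hQ u hu)
        (Sublist.trans (by simp) h)) hv
    · exact absurd (mem_of_sublist_between (hP v hv) (hQ v hv)
        (Sublist.trans (by simp) h)) hu
    · right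
      refine ⟨u, v, huv, ?_⟩
      have := h.filter (fun z => decide (z ∉ C))
      have e1 : P.filter (fun z => decide (z ∉ C)) = P := by
        simp only [List.filter_eq_self, decide_eq_true_eq]
        exact fun z hz hc => hP z hc hz
      have e2 : Q.filter (fun z => decide (z ∉ C)) = Q := by
        simp only [List.filter_eq_self, decide_eq_true_eq]
        exact fun z hz hc => hQ z hc hz
      have e3 : C.filter (fun z => decide (z ∉ C)) = [] := by
        simp [List.filter_eq_nil_iff]
      simp only [List.filter_append, e1, e2, e3] at this
      simpa [hu, hv] using this
  · rintro (⟨u, v, huv, h⟩ | ⟨u, v, huv, h⟩)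
    · exact ⟨u, v, huv, h.trans (by simp)⟩
    · exact ⟨u, v, huv, h.trans (by simp)⟩

theorem sublist_append_cons_cons {w s t : List ℕ} {x : ℕ} (hw : w.IsChain (· ≠ ·))
    (h : w <+ s ++ x :: x :: t) : w <+ s ++ x :: t := by
  induction s generalizing w with
  | nil =>
    cases h with
    | cons _ h => exact h
    | cons_cons _ h =>
      cases h with
      | cons _ h => exact h.cons_cons x
      | cons_cons _ h => simp at hw
  | cons y s ih =>
    rw [List.cons_append] at h ⊢
    cases h with
    | cons _ h => exact (ih hw h).cons y
    | cons_cons _ h => exact (ih hw.tail h).cons_cons y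

/-- Canonical sequential forms of non-crossing partitions, of any length. -/
def NC (l : List ℕ) : Prop := Growth 0 l ∧ ¬ Crossing l

theorem ncseq_iff {n : ℕ} {l : List ℕ} : NCseq n l ↔ l.length = n ∧ NC l := by
  rw [NCseq, NC, isRGS_iff_growth]

theorem nc_append_cons_cons {s t : List ℕ} {x : ℕ} :
    NC (s ++ x :: x :: t) ↔ NC (s ++ x :: t) := by
  refine and_congr ?_ (not_congr ?_)
  · simp only [growth_append, Growth, max_assoc, max_self]
    constructor
    · rintro ⟨h1, h2, -, h3⟩; exact ⟨h1, h2, h3⟩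
    · rintro ⟨h1, h2, h3⟩; exact ⟨h1, h2, ⟨h2.1, by omega⟩, h3⟩
  · simp only [crossing_iff_sublist]
    refine exists_congr fun u => exists_congr fun v => and_congr_right fun huv => ⟨?_, ?_⟩
    · exact sublist_append_cons_cons (by simp [huv.ne, huv.ne'])
    · exact fun h => h.trans (by simp)

theorem nc_append_replicate {s t : List ℕ} {x k : ℕ} :
    NC (s ++ List.replicate (k + 1) x ++ t) ↔ NC (s ++ x :: t) := by
  induction k with
  | zero => simp
  | succ k ih =>
    rw [← ih]
    simp only [List.replicate_succ, List.append_assoc, List.cons_append]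
    exact nc_append_cons_cons

theorem nc_insert {P A Q : List ℕ} (hA : ∀ x ∈ A, 1 ≤ x) :
    NC (P ++ A.map (· + maxLetter P) ++ Q.map (shift (maxLetter P) (maxLetter A))) ↔
      NC A ∧ NC (P ++ Q) := by
  have hP : P.map (shift (maxLetter P) (maxLetter A)) = P := by
    conv_rhs => rw [← List.map_id P]
    exact List.map_congr_left fun x hx => by simp [shift, le_maxLetter hx]
  have hc : Crossing (P ++ Q.map (shift (maxLetter P) (maxLetter A))) ↔ Crossing (P ++ Q) := by
    rw [← crossing_map (shift_strictMono (maxLetter P) (maxLetter A)) (l := P ++ Q),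
      List.map_append, hP]
  have hc2 : Crossing (A.map (· + maxLetter P)) ↔ Crossing A :=
    crossing_map (fun u v h => by simpa using h)
  have hg := @growth_map_add 0 (maxLetter P) A hA
  rw [zero_add] at hg
  simp only [NC]
  rw [crossing_append_iff, hc, hc2, growth_append, growth_append, growth_append, maxLetter_append,
    Nat.zero_max, Nat.zero_max, max_maxLetter_map_add, growth_map_shift le_rfl, hg]
  · tauto
  · intro x hx hx'
    obtain ⟨y, hy, rfl⟩ := List.mem_map.1 hx
    have := le_maxLetter hx'
    have := hA y hy
    omega
  · intro x hx hx'
    obtain ⟨y, hy, rfl⟩ := List.mem_map.1 hx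
    obtain ⟨z, hz, e⟩ := List.mem_map.1 hx'
    have := le_maxLetter hy
    have := hA y hy
    unfold shift at e
    split_ifs at e <;> omega

theorem NC.exists_insert {P C Q : List ℕ} (h : NC (P ++ C ++ Q)) (hP : ∀ x ∈ C, x ∉ P)
    (hQ : ∀ x ∈ C, x ∉ Q) :
    ∃ A Q', NC A ∧ NC (P ++ Q') ∧ C = A.map (· + maxLetter P) ∧
      Q = Q'.map (shift (maxLetter P) (maxLetter A)) := by
  have hg := h.1
  rw [growth_append, growth_append, Nat.zero_max] at hg
  obtain ⟨⟨gP, gC⟩, gQ⟩ := hg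
  have hlt : ∀ x ∈ C, maxLetter P < x := by
    intro x hx
    by_contra! hle
    exact hP x hx (gP.mem (gC.pos x hx) hle)
  obtain ⟨A, hA, rfl⟩ : ∃ A : List ℕ, (∀ x ∈ A, 1 ≤ x) ∧ C = A.map (· + maxLetter P) := by
    refine ⟨C.map (· - maxLetter P), ?_, ?_⟩
    · intro x hx
      obtain ⟨y, hy, rfl⟩ := List.mem_map.1 hx
      have := hlt y hy
      omega
    · conv_lhs => rw [← List.map_id C]
      rw [List.map_map]
      refine List.map_congr_left fun x hx => ?_
      have := hlt x hx
      simp only [id, Function.comp]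
      omega
  have gA : Growth 0 A := by
    have hg := @growth_map_add 0 (maxLetter P) A hA
    rw [zero_add] at hg
    exact hg.1 gC
  obtain ⟨Q', rfl⟩ : ∃ Q' : List ℕ, Q = Q'.map (shift (maxLetter P) (maxLetter A)) := by
    refine ⟨Q.map (fun v => if v ≤ maxLetter P then v else v - maxLetter A), ?_⟩
    conv_lhs => rw [← List.map_id Q]
    rw [List.map_map]
    refine List.map_congr_left fun x hx => ?_
    have hx' : x ≤ maxLetter P ∨ maxLetter P + maxLetter A < x := by
      by_contra! hn
      refine hQ x (List.mem_map.2 ⟨x - maxLetter P, gA.mem ?_ ?_, ?_⟩) hx <;> omega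
    simp only [id, Function.comp, shift]
    split_ifs <;> omega
  have := (nc_insert hA).1 h
  exact ⟨A, Q', this.1, this.2, rfl, rfl⟩

theorem Growth.map_eq_self {f : ℕ → ℕ} {l : List ℕ} (h : Growth 0 l)
    (h' : Growth 0 (l.map f)) (hf : ∀ x ∈ l, ∀ y ∈ l, f x = f y → x = y) : l.map f = l := by
  induction l using List.reverseRecOn with
  | nil => rfl
  | append_singleton s x ih =>
    rw [List.map_append, growth_append] at h'
    rw [growth_append] at h
    have e := ih h.1 h'.1 (fun y hy z hz => hf y (by simp [hy]) z (by simp [hz]))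
    simp only [e, Nat.zero_max, List.map_cons, List.map_nil, Growth, and_true] at h h'
    have key : f x = x := by
      by_cases hx : x ∈ s
      · have e' : s.map f = s.map id := by simpa using e
        exact List.map_inj_left.1 e' x hx
      · have hfx : f x ∉ s := by
          intro hm
          rw [← e] at hm
          obtain ⟨y, hy, hyx⟩ := List.mem_map.1 hm
          exact hx (hf y (by simp [hy]) x (by simp) hyx ▸ hy)
        have h1 : ¬ x ≤ maxLetter s := fun hl => hx (h.1.mem h.2.1 hl)
        have h2 : ¬ f x ≤ maxLetter s := fun hl => hfx (h.1.mem h'.2.1 hl)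
        omega
    simp [e, key]

theorem ordIso_map {f : ℕ → ℕ} {s : List ℕ} (hf : StrictMonoOn f {x | x ∈ s}) :
    OrdIso s (s.map f) := by
  refine ⟨by simp, fun j k hj hk => ?_⟩
  rw [List.getD_eq_getElem _ _ hj, List.getD_eq_getElem _ _ hk,
    List.getD_eq_getElem _ _ (by simpa using hj), List.getD_eq_getElem _ _ (by simpa using hk),
    List.getElem_map, List.getElem_map]
  exact (hf.lt_iff_lt (List.getElem_mem hj) (List.getElem_mem hk)).symm

theorem OrdIso.exists_map {s t : List ℕ} (h : OrdIso s t) :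
    ∃ f, StrictMonoOn f {x | x ∈ s} ∧ t = s.map f := by
  obtain ⟨hl, h⟩ := h
  have key : ∀ j (hj : j < s.length), t.getD (s.idxOf s[j]) 0 = t.getD j 0 := by
    intro j hj
    have hi : s.idxOf s[j] < s.length := List.idxOf_lt_length_of_mem (List.getElem_mem hj)
    have e : s.getD (s.idxOf s[j]) 0 = s.getD j 0 := by
      rw [List.getD_eq_getElem _ _ hi, List.getD_eq_getElem _ _ hj, List.getElem_idxOf]
    have h1 := h _ _ hi hj
    have h2 := h _ _ hj hi
    omega
  refine ⟨fun x => t.getD (s.idxOf x) 0, ?_, ?_⟩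
  · rintro x hx y hy hxy
    obtain ⟨i, hi, rfl⟩ := List.getElem_of_mem hx
    obtain ⟨j, hj, rfl⟩ := List.getElem_of_mem hy
    simp only [key]
    rw [← h i j hi hj, List.getD_eq_getElem _ _ hi, List.getD_eq_getElem _ _ hj]
    exact hxy
  · refine List.ext_getElem (by simp [hl]) fun j hj hj' => ?_
    rw [List.getElem_map, key, List.getD_eq_getElem _ _ hj]

/-- The non-crossing word encoded by a binary tree. -/
def treeWord : BinaryTree Unit → List ℕ
  | .nil => []
  | .node _ A B => [1] ++ (treeWord A).map (· + 1) ++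
      (treeWord B).map (shift 1 (maxLetter (treeWord A)))

theorem length_treeWord (t : BinaryTree Unit) : (treeWord t).length = t.numNodes := by
  induction t with
  | nil => rfl
  | node _ A B hA hB => simp [treeWord, hA, hB, BinaryTree.numNodes]

theorem NC.eq_nil_or_cons {l : List ℕ} (h : NC l) : l = [] ∨ ∃ t, l = 1 :: t := by
  cases l with
  | nil => simp
  | cons x t =>
    have := h.1.1
    obtain rfl : x = 1 := by omega
    simp

theorem nc_singleton : NC [1] :=
  ⟨by simp [Growth], by rintro ⟨i, j, k, m, h⟩; simp at h; omega⟩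

theorem nc_treeWord (t : BinaryTree Unit) : NC (treeWord t) := by
  induction t with
  | nil => exact ⟨trivial, by rintro ⟨i, j, k, m, h⟩; simp [treeWord] at h⟩
  | node _ A B hA hB =>
    refine (nc_insert (P := [1]) hA.1.pos).2 ⟨hA, ?_⟩
    rcases hB.eq_nil_or_cons with e | ⟨t, e⟩
    · simpa [e] using nc_singleton
    · rw [e] at hB ⊢
      exact (nc_append_cons_cons (s := [])).2 hB

theorem span_append {s t : List ℕ} (hs : ∀ x ∈ s, x ≠ 1) (ht : t = [] ∨ ∃ t', t = 1 :: t') :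
    (s ++ t).takeWhile (· ≠ 1) = s ∧ (s ++ t).dropWhile (· ≠ 1) = t := by
  have hs' : ∀ x ∈ s, decide (x ≠ 1) = true := by simpa using hs
  rw [List.takeWhile_append_of_pos hs', List.dropWhile_append_of_pos hs']
  rcases ht with rfl | ⟨t', rfl⟩ <;> simp

theorem treeWord_injective : Function.Injective treeWord := by
  intro s t h
  induction s generalizing t with
  | nil => cases t <;> simp_all [treeWord]
  | node _ A B hA hB =>
    cases t with
    | nil => simp [treeWord] at h
    | node _ A' B' =>
      simp only [treeWord, List.append_assoc, List.append_cancel_left_eq] at h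
      have key : ∀ A B : BinaryTree Unit,
          (∀ x ∈ (treeWord A).map (· + 1), x ≠ 1) ∧
          ((treeWord B).map (shift 1 (maxLetter (treeWord A))) = [] ∨
            ∃ t', (treeWord B).map (shift 1 (maxLetter (treeWord A))) = 1 :: t') := by
        intro A B
        constructor
        · intro x hx
          obtain ⟨y, hy, rfl⟩ := List.mem_map.1 hx
          have := (nc_treeWord A).1.pos y hy
          omega
        · rcases (nc_treeWord B).eq_nil_or_cons with e | ⟨t, e⟩ <;> simp [e, shift]
      have h1 := span_append (key A B).1 (key A B).2
      have h2 := span_append (key A' B').1 (key A' B').2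
      rw [h] at h1
      have eA := hA (List.map_injective_iff.2 (add_left_injective 1) (h1.1.symm.trans h2.1))
      subst eA
      have eB := hB (List.map_injective_iff.2 (shift_strictMono _ _).injective
        (h1.2.symm.trans h2.2))
      rw [eB]

theorem NC.exists_treeWord {l : List ℕ} (h : NC l) : ∃ t, treeWord t = l := by
  induction hn : l.length using Nat.strong_induction_on generalizing l with
  | _ n ih =>
    subst hn
    rcases h.eq_nil_or_cons with rfl | ⟨t, rfl⟩
    · exact ⟨.nil, rfl⟩
    · set C := t.takeWhile (· ≠ 1) with hC
      set Q := t.dropWhile (· ≠ 1) with hQ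
      have et : t = C ++ Q := (List.takeWhile_append_dropWhile).symm
      have hC1 : ∀ x ∈ C, x ≠ 1 := fun x hx => by simpa using List.mem_takeWhile_imp hx
      have hQ1 : Q = [] ∨ ∃ t', Q = 1 :: t' := by
        rcases hq : Q with _ | ⟨x, t'⟩
        · simp
        · have hne : t.dropWhile (· ≠ 1) ≠ [] := by rw [← hQ, hq]; simp
          have := List.head_dropWhile_not (fun x : ℕ => decide (x ≠ 1)) hne
          simp only [← hQ, hq] at this
          have hx : x = 1 := by simpa using of_decide_eq_false this
          simp [hx]
      have h' : NC ([1] ++ C ++ Q) := by simpa [et] using h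
      obtain ⟨A, Q', hA, hPQ, eC, eQ⟩ := h'.exists_insert
        (by simpa using hC1) (by
          intro y hy hyQ
          rcases hQ1 with e | ⟨t', e⟩
          · simp [e] at hyQ
          · rw [e] at hyQ
            have hy1 := hC1 y hy
            have hy0 := h'.1.pos y (by simp [hy])
            have hyt : y ∈ t' := by simpa [hy1] using hyQ
            refine h'.2 (crossing_iff_sublist.2 ⟨1, y, by omega, ?_⟩)
            rw [e]
            have s1 := List.singleton_sublist.2 hy
            have s2 := List.singleton_sublist.2 hyt
            exact ((Sublist.refl [1]).append s1).append (s2.cons_cons 1))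
      have hQ' : NC Q' := by
        rcases hQ1 with e | ⟨t', e⟩
        · rw [e] at eQ
          have : Q' = [] := by simpa using eQ.symm
          subst this
          exact ⟨trivial, by rintro ⟨i, j, k, m, h⟩; simp at h⟩
        · rcases Q' with _ | ⟨x, q⟩
          · simp [e] at eQ
          · have hx : x = 1 := by
              have := hPQ.1.pos x (by simp)
              simp only [e, List.map_cons, List.cons.injEq, shift] at eQ
              split_ifs at eQ <;> omega
            subst hx
            exact (nc_append_cons_cons (s := [])).1 hPQ
      have lC : C.length = A.length := by simp [eC]
      have lQ : Q.length = Q'.length := by rw [eQ]; simp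
      have lt : (1 :: t).length = 1 + A.length + Q'.length := by
        rw [et]; simp; omega
      obtain ⟨tA, rfl⟩ := ih A.length (by omega) hA rfl
      obtain ⟨tQ, rfl⟩ := ih Q'.length (by omega) hQ' rfl
      refine ⟨.node () tA tQ, ?_⟩
      rw [et, eC, eQ]
      simp [treeWord]

theorem card_ncseq (n : ℕ) : Nat.card {l // NCseq n l} = catalan n := by
  rw [← BinaryTree.treesOfNumNodesEq_card_eq_catalan, ← Fintype.card_coe,
    ← Nat.card_eq_fintype_card]
  refine (Nat.card_congr (Equiv.ofBijective (fun t => ⟨treeWord t.1, ncseq_iff.2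
    ⟨(length_treeWord _).trans (BinaryTree.mem_treesOfNumNodesEq.1 t.2), nc_treeWord _⟩⟩)
    ⟨?_, ?_⟩)).symm
  · intro s t h
    exact Subtype.ext (treeWord_injective (Subtype.ext_iff.1 h))
  · rintro ⟨l, hl⟩
    obtain ⟨e, hl⟩ := ncseq_iff.1 hl
    obtain ⟨t, rfl⟩ := hl.exists_treeWord
    exact ⟨⟨t, BinaryTree.mem_treesOfNumNodesEq.2 ((length_treeWord t).symm.trans e)⟩, rfl⟩

theorem catalan_mul_self (r : ℕ) : catalan r * r = Nat.choose (2 * r) (r + 1) := by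
  have h1 := succ_mul_catalan_eq_centralBinom r
  have h2 := Nat.choose_succ_right_eq (2 * r) r
  rw [show 2 * r - r = r by omega, ← Nat.centralBinom_eq_two_mul_choose, ← h1] at h2
  refine Nat.eq_of_mul_eq_mul_right (Nat.succ_pos r) ?_
  rw [Nat.succ_eq_add_one, h2]
  ring

theorem maxLetter_replicate_succ (k x : ℕ) : maxLetter (List.replicate (k + 1) x) = x := by
  induction k with
  | zero => simp
  | succ k ih => rw [List.replicate_succ, maxLetter_cons, ih, max_self]

/-- The word `α x β` with its letter `x` blown up to an occurrence of `1^a(ρ+1)1^b`, the letters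
of `β` being raised accordingly. -/
def inflate (a b : ℕ) (ρ α : List ℕ) (x : ℕ) (β : List ℕ) : List ℕ :=
  α ++ List.replicate a x ++ ρ.map (· + max (maxLetter α) x) ++
    (List.replicate b x ++ β.map (shift (max (maxLetter α) x) (maxLetter ρ)))

theorem nc_inflate {a b x : ℕ} {ρ α β : List ℕ} (hρ : NC ρ) :
    NC (inflate (a + 1) (b + 1) ρ α x β) ↔ NC (α ++ x :: β) := by
  have h := nc_insert (P := α ++ List.replicate (a + 1) x)
    (Q := List.replicate (b + 1) x ++ β) hρ.1.pos
  have hx : shift (max (maxLetter α) x) (maxLetter ρ) x = x := by simp [shift]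
  rw [maxLetter_append, maxLetter_replicate_succ, List.map_append, List.map_replicate, hx] at h
  rw [inflate, h, ← nc_append_replicate (k := a + 1 + b), ← List.append_assoc,
    List.append_assoc α, List.replicate_append_replicate]
  exact and_iff_right hρ

theorem occAt_inflate {a b x : ℕ} {ρ α β : List ℕ} (hρ : ∀ y ∈ ρ, 1 ≤ y) :
    occAt (List.replicate a 1 ++ ρ.map (· + 1) ++ List.replicate b 1) (inflate a b ρ α x β)
      α.length := by
  set τ := List.replicate a 1 ++ ρ.map (· + 1) ++ List.replicate b 1 with hτ
  set f : ℕ → ℕ := fun v => if v ≤ 1 then x else v - 1 + max (maxLetter α) x with hf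
  have hpos : ∀ y ∈ τ, 1 ≤ y := by
    intro y hy
    simp only [hτ, List.mem_append, List.mem_replicate, List.mem_map] at hy
    rcases hy with (⟨-, rfl⟩ | ⟨z, -, rfl⟩) | ⟨-, rfl⟩ <;> omega
  have hmap : τ.map f = List.replicate a x ++ ρ.map (· + max (maxLetter α) x) ++
      List.replicate b x := by
    have : ρ.map (f ∘ (· + 1)) = ρ.map (· + max (maxLetter α) x) :=
      List.map_congr_left fun y hy => by
        have := hρ y hy
        have : ¬ y + 1 ≤ 1 := by omega
        simp [hf, this]
    simp only [hτ, List.map_append, List.map_replicate, List.map_map, this]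
    simp [hf]
  have htake : ((inflate a b ρ α x β).drop α.length).take τ.length = τ.map f := by
    have : inflate a b ρ α x β =
        α ++ (τ.map f ++ β.map (shift (max (maxLetter α) x) (maxLetter ρ))) := by
      simp [inflate, hmap]
    rw [this, List.drop_left, List.take_left' (by simp)]
  rw [occAt, htake]
  refine ordIso_map fun y hy z hz hyz => ?_
  have := hpos y hy
  have := hpos z hz
  simp only [hf]
  split_ifs <;> omega

theorem NC.exists_inflate {a b i : ℕ} {ρ l : List ℕ} (hl : NC l) (hρ : NC ρ)
    (h : occAt (List.replicate (a + 1) 1 ++ ρ.map (· + 1) ++ List.replicate (b + 1) 1) l i) :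
    ∃ α x β, α.length = i ∧ l = inflate (a + 1) (b + 1) ρ α x β := by
  obtain ⟨f, hf, e⟩ := OrdIso.exists_map h
  have hlen := h.1
  set τ := List.replicate (a + 1) 1 ++ ρ.map (· + 1) ++ List.replicate (b + 1) 1 with hτ
  have hi : i ≤ l.length := by
    by_contra! hlt
    have : 0 < τ.length := by simp [hτ]
    rw [List.drop_eq_nil_of_le hlt.le, List.take_nil, List.length_nil] at hlen
    omega
  obtain ⟨α, γ, hα, rfl⟩ : ∃ α γ : List ℕ, α.length = i ∧ l = α ++ γ :=
    ⟨l.take i, l.drop i, by simpa using hi, by simp⟩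
  subst hα
  rw [List.drop_left] at e
  obtain ⟨β, rfl⟩ : ∃ β, γ = τ.map f ++ β :=
    ⟨γ.drop τ.length, by rw [← e, List.take_append_drop]⟩
  have h1τ : 1 ∈ τ := by simp [hτ]
  have hρτ : ∀ y ∈ ρ, y + 1 ∈ τ := fun y hy => by simp [hτ, hy]
  set C := ρ.map (fun y => f (y + 1)) with hC
  have hτf : τ.map f = List.replicate (a + 1) (f 1) ++ C ++ List.replicate (b + 1) (f 1) := by
    simp only [hτ, hC, List.map_append, List.map_replicate, List.map_map, Function.comp_def]
  set x := f 1 with hx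
  have hlt : ∀ y ∈ C, x < y := by
    intro y hy
    obtain ⟨z, hz, rfl⟩ := List.mem_map.1 hy
    have := hρ.1.pos z hz
    exact hf h1τ (hρτ z hz) (by omega)
  have hl' : NC ((α ++ List.replicate (a + 1) x) ++ C ++ (List.replicate (b + 1) x ++ β)) := by
    simpa [hτf] using hl
  have hxa : [x] <+ List.replicate (a + 1) x := by simp
  have hxb : [x] <+ List.replicate (b + 1) x := by simp
  have hx1 : 1 ≤ x := hl'.1.pos x (by simp)
  obtain ⟨A, Q, hA, -, eC, eQ⟩ := hl'.exists_insert (by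
      intro y hy hyP
      have hyα : y ∈ α := by
        have := hlt y hy
        simp only [List.mem_append, List.mem_replicate] at hyP
        exact hyP.resolve_right (by omega)
      have hxy : [x, y] <+ α := by
        obtain ⟨s, t, rfl⟩ := List.append_of_mem hyα
        have hg := hl'.1
        rw [List.append_assoc, List.append_assoc, List.append_assoc, growth_append] at hg
        have hyx := hlt y hy
        have hys := hg.2.1.2
        have := hg.1.mem (x := x) (by omega) (by omega)
        exact (List.singleton_sublist.2 this).append (by simp : [y] <+ y :: t)
      refine hl'.2 (crossing_iff_sublist.2 ⟨x, y, hlt y hy, ?_⟩)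
      exact ((hxy.append hxa).append (List.singleton_sublist.2 hy)).trans (by simp)) (by
      intro y hy hyQ
      have hyβ : y ∈ β := by
        have := hlt y hy
        simp only [List.mem_append, List.mem_replicate] at hyQ
        exact hyQ.resolve_left (by omega)
      refine hl'.2 (crossing_iff_sublist.2 ⟨x, y, hlt y hy, ?_⟩)
      exact ((hxa.trans (List.sublist_append_right α _)).append
        (List.singleton_sublist.2 hy)).append (hxb.append (List.singleton_sublist.2 hyβ)))
  rw [maxLetter_append, maxLetter_replicate_succ] at eC eQ
  set M := max (maxLetter α) x with hM
  have eA : A = ρ.map (fun y => f (y + 1) - M) := by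
    have := congrArg (List.map (· - M)) eC
    rw [hC, List.map_map, List.map_map] at this
    simpa [Function.comp_def] using this.symm
  have hAρ : A = ρ := by
    rw [eA]
    refine hρ.1.map_eq_self (eA ▸ hA.1) fun y hy z hz hyz => ?_
    have hge : ∀ y ∈ ρ, M ≤ f (y + 1) := by
      intro y hy
      have : f (y + 1) ∈ C := List.mem_map.2 ⟨y, hy, rfl⟩
      rw [eC] at this
      obtain ⟨w, -, hw⟩ := List.mem_map.1 this
      omega
    have h1 := hge y hy
    have h2 := hge z hz
    have := hf.injOn (hρτ y hy) (hρτ z hz) (by omega)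
    omega
  subst hAρ
  obtain ⟨Q₁, Q₂, rfl, -, e2⟩ := List.append_eq_map_iff.1 eQ
  refine ⟨α, x, Q₂, rfl, ?_⟩
  rw [hτf, eC, ← e2, inflate]
  simp [hM]

theorem inflate_injective {a b x x' : ℕ} {ρ α α' β β' : List ℕ} (hα : α.length = α'.length)
    (h : inflate (a + 1) b ρ α x β = inflate (a + 1) b ρ α' x' β') :
    α = α' ∧ x = x' ∧ β = β' := by
  simp only [inflate, List.append_assoc] at h
  obtain ⟨rfl, h⟩ := List.append_inj h hα
  obtain ⟨hx, h⟩ := List.append_inj h (by simp)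
  obtain rfl : x = x' := by simpa using hx
  simp only [List.append_cancel_left_eq] at h
  exact ⟨rfl, rfl, List.map_injective_iff.2 (shift_strictMono _ _).injective h⟩

theorem length_inflate (a b x : ℕ) (ρ α β : List ℕ) :
    (inflate a b ρ α x β).length = α.length + a + ρ.length + b + β.length := by
  simp [inflate]; omega

/-- For τ = 1^a(ρ+1)1^b with ρ a non-crossing canonical form of length m ≥ 1,
a, b ≥ 1 and n ≥ m + a + b − 1, the total number of occurrences of τ over
NC_n equals binom(2r, r+1), where r = n − m − a − b + 1. -/
theorem stmt14 (m a b n : ℕ) (ρ : List ℕ) (hm : 1 ≤ m) (ha : 1 ≤ a)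
    (hb : 1 ≤ b) (hρ : NCseq m ρ) (hn : m + a + b - 1 ≤ n) :
    totalOcc n (List.replicate a 1 ++ ρ.map (· + 1) ++ List.replicate b 1) =
      Nat.choose (2 * (n + 1 - m - a - b)) ((n + 1 - m - a - b) + 1) := by
  obtain ⟨a, rfl⟩ : ∃ a', a = a' + 1 := ⟨a - 1, by omega⟩
  obtain ⟨b, rfl⟩ : ∃ b', b = b' + 1 := ⟨b - 1, by omega⟩
  obtain ⟨rfl, hρ'⟩ := ncseq_iff.1 hρ
  set r := n + 1 - ρ.length - (a + 1) - (b + 1) with hr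
  have hcard : Nat.card ({l // NCseq r l} × Fin r) = Nat.choose (2 * r) (r + 1) := by
    rw [Nat.card_prod, card_ncseq, Nat.card_fin, catalan_mul_self]
  rw [← hcard, totalOcc]
  symm
  refine Nat.card_congr (Equiv.ofBijective (fun p =>
    ⟨(inflate (a + 1) (b + 1) ρ (p.1.1.take p.2) (p.1.1.getD p.2 0) (p.1.1.drop (p.2 + 1)), p.2),
      ?_⟩) ⟨?_, ?_⟩)
  · obtain ⟨⟨l, hl⟩, i, hi⟩ := p
    obtain ⟨e, hl⟩ := ncseq_iff.1 hl
    have hil : i < l.length := by omega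
    have hdec : l.take i ++ l.getD i 0 :: l.drop (i + 1) = l := by
      rw [List.getD_eq_getElem _ _ hil, ← List.drop_eq_getElem_cons hil, List.take_append_drop]
    refine ⟨ncseq_iff.2 ⟨?_, (nc_inflate hρ').2 (by rwa [hdec])⟩, ?_⟩
    · simp only [length_inflate, List.length_take, List.length_drop]
      omega
    · have := occAt_inflate (a := a + 1) (b := b + 1) (x := l.getD i 0) (α := l.take i)
        (β := l.drop (i + 1)) hρ'.1.pos
      rwa [List.length_take, min_eq_left hil.le] at this
  · rintro ⟨⟨l, hl⟩, i⟩ ⟨⟨l', hl'⟩, j⟩ h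
    simp only [Subtype.mk.injEq, Prod.mk.injEq] at h
    obtain ⟨h, hij⟩ := h
    obtain rfl := Fin.ext hij
    have hil : (i : ℕ) < l.length := by rw [hl.1]; exact i.2
    have hil' : (i : ℕ) < l'.length := by rw [hl'.1]; exact i.2
    obtain ⟨h1, h2, h3⟩ := inflate_injective (by simp [hl.1, hl'.1]) h
    have : l = l' := by
      rw [← List.take_append_drop i l, ← List.take_append_drop i l',
        List.drop_eq_getElem_cons hil, List.drop_eq_getElem_cons hil', h1, h3,
        ← List.getD_eq_getElem _ 0 hil, ← List.getD_eq_getElem _ 0 hil', h2]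
    subst this
    rfl
  · rintro ⟨⟨l, i⟩, hl, hocc⟩
    obtain ⟨e, hl⟩ := ncseq_iff.1 hl
    obtain ⟨α, x, β, rfl, rfl⟩ := hl.exists_inflate hρ' hocc
    rw [length_inflate] at e
    refine ⟨⟨⟨α ++ x :: β, ncseq_iff.2 ⟨?_, (nc_inflate hρ').1 hl⟩⟩, α.length, ?_⟩, ?_⟩
    · simp only [List.length_append, List.length_cons]
      omega
    · omega
    · simp [List.getD_eq_getElem?_getD]
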